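/- arXiv:2203.01840 — 7 statements merged into one kernel-verified Lean document; each statement's English description precedes it below -/
import Mathlib

section
/- Let k be a field and d ≥ 1 an integer such that d! is invertible in k (i.e., the characteristic of k does not divide d!). Let A := k[y]/(y^{2d}), the quotient of the polynomial ring k[y] by the ideal generated by y^{2d}, and let ȳ denote the image of y in A. Then a k-algebra automorphism φ of A satisfies φ(ȳ^d) = ȳ^d if and only if there exist α ∈ k with α^d = 1 and elements a_1, …, a_{d−1} ∈ k such that φ(ȳ) = α·ȳ + Σ_{i=1}^{d−1} a_i·ȳ^{d+i}. Moreover, such α and a_1, …, a_{d−1} are uniquely determined by φ. -/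
open Polynomial

/-- The algebra `A = k[y]/(y^(2d))`. -/
abbrev Aq (k : Type*) [CommRing k] (d : ℕ) : Type _ :=
  Polynomial k ⧸ Ideal.span {(X : Polynomial k) ^ (2 * d)}

/-- The image `ȳ` of `y` in `A = k[y]/(y^(2d))`. -/
noncomputable abbrev ybar (k : Type*) [CommRing k] (d : ℕ) : Aq k d :=
  Ideal.Quotient.mk _ (X : Polynomial k)

/-- The polynomial built from `a` has `i`-th coefficient `a i`. -/
theorem coeff_sum_fin_C_mul_X_pow {R : Type*} [CommRing R] {n : ℕ} (a : Fin n → R) (i : Fin n) :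
    (∑ j : Fin n, C (a j) * X ^ (j : ℕ) : R[X]).coeff i = a i := by
  simp [coeff_X_pow, Fin.val_inj]

theorem X_pow_dvd_sub_sum_fin_coeff {R : Type*} [CommRing R] (r : R[X]) (n : ℕ) :
    X ^ n ∣ r - ∑ j : Fin n, C (r.coeff j) * X ^ (j : ℕ) := by
  rw [X_pow_dvd_iff]
  intro m hm
  have := coeff_sum_fin_C_mul_X_pow (fun j : Fin n => r.coeff j) ⟨m, hm⟩
  simp only at this
  rw [coeff_sub, this, sub_self]

/-- A `d`-th root of `1` modulo `X ^ m` is constant modulo `X ^ m` when `d` is invertible. -/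
theorem X_pow_dvd_sub_C_of_X_pow_dvd_pow_sub_one {k : Type*} [Field k] {d m : ℕ} (hm : m ≠ 0)
    (hd : (d : k) ≠ 0) {q : k[X]} (h : X ^ m ∣ q ^ d - 1) :
    q.coeff 0 ^ d = 1 ∧ X ^ m ∣ q - C (q.coeff 0) := by
  have hroot : q.coeff 0 ^ d = 1 := by
    have h0 := X_dvd_iff.1 ((dvd_pow_self X hm).trans h)
    rw [coeff_zero_eq_eval_zero] at h0 ⊢
    simpa [sub_eq_zero] using h0
  have hα : q.coeff 0 ≠ 0 := by
    rintro h0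
    have hd0 : d ≠ 0 := by rintro rfl; simp at hd
    simp [h0, hd0] at hroot
  refine ⟨hroot, ?_⟩
  have hfac : q ^ d - 1 =
      (∑ i ∈ Finset.range d, q ^ i * C (q.coeff 0) ^ (d - 1 - i)) * (q - C (q.coeff 0)) := by
    rw [(Commute.all _ _).geom_sum₂_mul, ← C_pow, hroot, C_1]
  rw [hfac] at h
  refine IsCoprime.dvd_of_dvd_mul_left (IsCoprime.pow_left ?_) h
  rw [irreducible_X.coprime_iff_not_dvd, X_dvd_iff, coeff_zero_eq_eval_zero, eval_finsetSum]
  have hsum : ∀ i ∈ Finset.range d,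
      eval 0 (q ^ i * C (q.coeff 0) ^ (d - 1 - i)) = q.coeff 0 ^ (d - 1) := by
    intro i hi
    rw [Finset.mem_range] at hi
    rw [eval_mul, eval_pow, eval_pow, eval_C, ← coeff_zero_eq_eval_zero, ← pow_add]
    congr 1
    omega
  rw [Finset.sum_congr rfl hsum]
  simp [hd, hα]

/-- The `d`-th roots of `X ^ d` modulo `X ^ (2 * d)`. -/
theorem X_pow_dvd_pow_sub_X_pow_iff {k : Type*} [Field k] {d : ℕ} (hd : (d : k) ≠ 0) (p : k[X]) :
    X ^ (2 * d) ∣ p ^ d - X ^ d ↔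
      ∃ (α : k) (r : k[X]), α ^ d = 1 ∧ p = C α * X + X ^ (d + 1) * r := by
  have hd0 : d ≠ 0 := by rintro rfl; simp at hd
  have hX : (X ^ d : k[X]) ≠ 0 := pow_ne_zero _ X_ne_zero
  constructor
  · intro h
    have hp : X ∣ p := by
      refine prime_X.dvd_of_dvd_pow (n := d) ?_
      rw [← dvd_sub_left (dvd_pow_self X hd0)]
      exact (dvd_pow_self X (by omega)).trans h
    obtain ⟨q, rfl⟩ := hp
    rw [two_mul, pow_add, mul_pow, ← mul_sub_one, mul_dvd_mul_iff_left hX] at h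
    obtain ⟨hα, r, hr⟩ := X_pow_dvd_sub_C_of_X_pow_dvd_pow_sub_one hd0 hd h
    refine ⟨q.coeff 0, r, hα, ?_⟩
    linear_combination X * hr
  · rintro ⟨α, r, hα, rfl⟩
    have h : X ^ d ∣ (C α + X ^ d * r) ^ d - C α ^ d :=
      Dvd.dvd.trans ⟨r, by ring⟩ (sub_dvd_pow_sub_pow _ _ d)
    rw [← C_pow, hα, C_1] at h
    have heq : (C α * X + X ^ (d + 1) * r) ^ d - X ^ d =
        X ^ d * ((C α + X ^ d * r) ^ d - 1) := by
      rw [mul_sub_one, ← mul_pow]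
      ring
    rw [heq, two_mul, pow_add]
    exact mul_dvd_mul_left _ h

theorem Aq_mk_eq_mk_iff {k : Type*} [CommRing k] {d : ℕ} (p q : k[X]) :
    (Ideal.Quotient.mk _ p : Aq k d) = Ideal.Quotient.mk _ q ↔ X ^ (2 * d) ∣ p - q := by
  rw [Ideal.Quotient.eq, Ideal.mem_span_singleton]

theorem smul_ybar_add_sum_eq_mk {k : Type*} [CommRing k] {d n : ℕ} (α : k) (a : Fin n → k) :
    α • ybar k d + ∑ i : Fin n, a i • ybar k d ^ (d + 1 + (i : ℕ)) =
      Ideal.Quotient.mk _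
        (C α * X + X ^ (d + 1) * ∑ i : Fin n, C (a i) * X ^ (i : ℕ)) := by
  have hsmul : ∀ (c : k) (p : k[X]),
      (Ideal.Quotient.mk _ (C c * p) : Aq k d) = c • Ideal.Quotient.mk _ p := by
    intro c p
    rw [← smul_eq_C_mul]
    rfl
  rw [Finset.mul_sum, map_add, map_sum, hsmul]
  congr 1
  refine Finset.sum_congr rfl fun i _ => ?_
  rw [mul_left_comm, ← pow_add, hsmul, map_pow]

/-- A `k`-algebra automorphism `φ` of `A = k[y]/(y^(2d))` fixes `ȳ^d` if and only if
`φ(ȳ) = α·ȳ + ∑_{i=1}^{d-1} a_i ȳ^(d+i)` for some `α` with `α^d = 1` and `a_i ∈ k`;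
moreover such `α` and `a` are uniquely determined by `φ`. -/
theorem single_component_auts_points (k : Type*) [Field k] (d : ℕ) (hd : 1 ≤ d)
    (hfact : (Nat.factorial d : k) ≠ 0) (φ : Aq k d ≃ₐ[k] Aq k d) :
    (φ (ybar k d ^ d) = ybar k d ^ d ↔
      ∃ (α : k) (a : Fin (d - 1) → k), α ^ d = 1 ∧
        φ (ybar k d) = α • ybar k d +
          ∑ i : Fin (d - 1), a i • ybar k d ^ (d + 1 + (i : ℕ)))
    ∧ ∀ (α β : k) (a b : Fin (d - 1) → k),
        α ^ d = 1 → β ^ d = 1 →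
        φ (ybar k d) = α • ybar k d +
          ∑ i : Fin (d - 1), a i • ybar k d ^ (d + 1 + (i : ℕ)) →
        φ (ybar k d) = β • ybar k d +
          ∑ i : Fin (d - 1), b i • ybar k d ^ (d + 1 + (i : ℕ)) →
        α = β ∧ a = b := by
  have hdk : (d : k) ≠ 0 := by
    intro h
    apply hfact
    rw [← Nat.mul_factorial_pred (by omega), Nat.cast_mul, h, zero_mul]
  obtain ⟨p, hp⟩ := Ideal.Quotient.mk_surjective (φ (ybar k d))
  have hsplit : 2 * d = d + 1 + (d - 1) := by omega
  simp only [smul_ybar_add_sum_eq_mk, map_pow, ← hp]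
  refine ⟨?_, ?_⟩
  · rw [← map_pow, ← map_pow, Aq_mk_eq_mk_iff, X_pow_dvd_pow_sub_X_pow_iff hdk]
    constructor
    · rintro ⟨α, r, hα, rfl⟩
      refine ⟨α, fun i => r.coeff i, hα, ?_⟩
      rw [Aq_mk_eq_mk_iff, add_sub_add_left_eq_sub, ← mul_sub, hsplit, pow_add _ (d + 1)]
      exact mul_dvd_mul_left _ (X_pow_dvd_sub_sum_fin_coeff r (d - 1))
    · rintro ⟨α, a, hα, h⟩
      rw [Aq_mk_eq_mk_iff, hsplit, pow_add _ (d + 1)] at h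
      obtain ⟨s, hs⟩ := h
      refine ⟨α, ∑ i : Fin (d - 1), C (a i) * X ^ (i : ℕ) + X ^ (d - 1) * s, hα, ?_⟩
      linear_combination hs
  · intro α β a b _ _ ha hb
    have h := ha.symm.trans hb
    rw [Aq_mk_eq_mk_iff, X_pow_dvd_iff] at h
    refine ⟨?_, funext fun i => ?_⟩
    · have h1 := h 1 (by omega)
      have hd1 : ¬ d + 1 ≤ 1 := by omega
      simpa [coeff_X_pow_mul', hd1, sub_eq_zero, show d ≠ 0 by omega] using h1
    · have hi := h (i + (d + 1)) (by omega)
      have hX : ∀ c : k, (C c * X).coeff (i + (d + 1)) = 0 := by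
        intro c
        rw [coeff_C_mul, coeff_X_of_ne_one (by omega), mul_zero]
      rw [coeff_sub, coeff_add, coeff_add, hX, hX, coeff_X_pow_mul, coeff_X_pow_mul,
        coeff_sum_fin_C_mul_X_pow, coeff_sum_fin_C_mul_X_pow, zero_add, zero_add] at hi
      exact sub_eq_zero.1 hi
end

section
/- Let k be a field and d ≥ 1 an integer such that d! is invertible in k. Let A := k[y]/(y^{2d}), the quotient of the polynomial ring k[y] by the ideal generated by y^{2d}, and let ȳ denote the image of y in A. The group of k-algebra automorphisms φ of A satisfying φ(ȳ^d) = ȳ^d is isomorphic to a semidirect product k^{d−1} ⋊ μ_d(k), where μ_d(k) := {α ∈ k : α^d = 1} acts on the additive group k^{d−1} by α · (w_1, w_2, …, w_{d−1}) = (w_1, α·w_2, α²·w_3, …, α^{d−2}·w_{d−1}). The isomorphism can be chosen so that the pair ((w_i)_i, α) corresponds to the automorphism sending ȳ to α·ȳ + Σ_{i=1}^{d−1} α·w_i·ȳ^{d+i}. -/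
open Polynomial

theorem ybar_pow_two_mul (k : Type*) [CommRing k] (d : ℕ) : ybar k d ^ (2 * d) = 0 := by
  rw [← map_pow]
  exact Ideal.Quotient.eq_zero_iff_mem.2 (Ideal.mem_span_singleton_self _)

theorem mk_eq_mk_iff_coeff {k : Type*} [CommRing k] {d : ℕ} {p q : k[X]} :
    (Ideal.Quotient.mk _ p : Aq k d) = Ideal.Quotient.mk _ q ↔
      ∀ n < 2 * d, p.coeff n = q.coeff n := by
  rw [Ideal.Quotient.eq, Ideal.mem_span_singleton, X_pow_dvd_iff]
  simp only [coeff_sub, sub_eq_zero]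

theorem algHom_ext_ybar {k : Type*} [CommRing k] {d : ℕ} {B : Type*} [Semiring B] [Algebra k B]
    {f g : Aq k d →ₐ[k] B} (h : f (ybar k d) = g (ybar k d)) : f = g :=
  Ideal.Quotient.algHom_ext _ (Polynomial.algHom_ext h)

theorem Aq.smul_def {k : Type*} [CommRing k] {d : ℕ} (a : k) (x : Aq k d) :
    a • x = algebraMap k (Aq k d) a * x :=
  Algebra.smul_def a x

/-- The polynomial `α y + ∑ α wᵢ y^(d+i)`, with the coordinates of `w` indexed from `0`. -/
noncomputable def autPoly {k : Type*} [CommRing k] {d : ℕ} (w : Fin (d - 1) → k) (α : k) : k[X] :=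
  C α * X + ∑ i : Fin (d - 1), C (α * w i) * X ^ (d + 1 + (i : ℕ))

theorem coeff_one_autPoly {k : Type*} [CommRing k] {d : ℕ} (hd : 1 ≤ d)
    (w : Fin (d - 1) → k) (α : k) : (autPoly w α).coeff 1 = α := by
  have h (i : Fin (d - 1)) : 1 ≠ d + 1 + (i : ℕ) := by omega
  simp [autPoly, finsetSum_coeff, -map_mul, coeff_C_mul, coeff_X_pow, h]

theorem coeff_add_autPoly {k : Type*} [CommRing k] {d : ℕ} (hd : 1 ≤ d)
    (w : Fin (d - 1) → k) (α : k) (j : Fin (d - 1)) :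
    (autPoly w α).coeff (d + 1 + j) = α * w j := by
  have h : 1 ≠ d + 1 + (j : ℕ) := by omega
  simp [autPoly, finsetSum_coeff, -map_mul, coeff_C_mul, coeff_X_pow, coeff_X, h, Fin.val_inj]

theorem coeff_autPoly_of_le {k : Type*} [CommRing k] {d : ℕ}
    (w : Fin (d - 1) → k) (α : k) {n : ℕ} (hn : n ≤ d) (h1 : n ≠ 1) :
    (autPoly w α).coeff n = 0 := by
  have h (i : Fin (d - 1)) : n ≠ d + 1 + (i : ℕ) := by omega
  simp [autPoly, finsetSum_coeff, -map_mul, coeff_C_mul, coeff_X_pow, coeff_X, h, h1.symm]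

theorem mk_autPoly {k : Type*} [CommRing k] {d : ℕ} (w : Fin (d - 1) → k) (α : k) :
    (Ideal.Quotient.mk _ (autPoly w α) : Aq k d) = α • ybar k d +
      ∑ i : Fin (d - 1), (α * w i) • ybar k d ^ (d + 1 + (i : ℕ)) := by
  have h (a : k) (p : k[X]) :
      (Ideal.Quotient.mk _ (C a * p) : Aq k d) = a • Ideal.Quotient.mk _ p := by
    rw [← smul_eq_C_mul]; rfl
  simp only [autPoly, map_add, map_sum, h, map_pow]

theorem exists_mk_autPoly_eq_mul {k : Type*} [CommRing k] {d : ℕ} (w : Fin (d - 1) → k) (α : k) :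
    ∃ h : Aq k d, Ideal.Quotient.mk _ (autPoly w α) =
      ybar k d * (algebraMap k _ α + ybar k d ^ d * h) := by
  refine ⟨∑ i : Fin (d - 1), (α * w i) • ybar k d ^ (i : ℕ), ?_⟩
  rw [mk_autPoly, mul_add, Aq.smul_def, mul_comm (algebraMap k (Aq k d) α),
    Finset.mul_sum, Finset.mul_sum]
  congr 1
  refine Finset.sum_congr rfl fun i _ => ?_
  rw [Aq.smul_def, Aq.smul_def]
  ring

theorem pow_mul_add_pow_mul_pow {A : Type*} [CommRing A] {y : A} {d : ℕ} (hy : y ^ (2 * d) = 0)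
    (a h : A) (j : ℕ) : y ^ d * (a + y ^ d * h) ^ j = y ^ d * a ^ j := by
  have hy' : y ^ d * y ^ d = 0 := by rw [← pow_add, ← two_mul, hy]
  induction j with
  | zero => simp
  | succ j ih =>
    rw [pow_succ, ← mul_assoc, ih]
    linear_combination a ^ j * h * hy'

theorem mk_autPoly_pow {k : Type*} [CommRing k] {d : ℕ} (w : Fin (d - 1) → k) {α : k}
    (hα : α ^ d = 1) :
    (Ideal.Quotient.mk _ (autPoly w α) : Aq k d) ^ d = ybar k d ^ d := by
  obtain ⟨h, hh⟩ := exists_mk_autPoly_eq_mul w α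
  rw [hh, mul_pow, pow_mul_add_pow_mul_pow (ybar_pow_two_mul k d), ← map_pow (algebraMap k (Aq k d)),
    hα, map_one, mul_one]

theorem mk_autPoly_pow_add {k : Type*} [CommRing k] {d : ℕ} (w : Fin (d - 1) → k) {α : k}
    (hα : α ^ d = 1) (j : ℕ) :
    (Ideal.Quotient.mk _ (autPoly w α) : Aq k d) ^ (d + j) = α ^ j • ybar k d ^ (d + j) := by
  obtain ⟨h, hh⟩ := exists_mk_autPoly_eq_mul w α
  rw [pow_add, mk_autPoly_pow w hα, hh, mul_pow, mul_left_comm,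
    pow_mul_add_pow_mul_pow (ybar_pow_two_mul k d), Aq.smul_def, map_pow (algebraMap k (Aq k d))]
  ring

/-- The endomorphism of `k[y]/(y^(2d))` sending `ȳ` to the class of `autPoly w α`. -/
noncomputable def autHom {k : Type*} [CommRing k] {d : ℕ} (w : Fin (d - 1) → k) {α : k}
    (hα : α ^ d = 1) : Aq k d →ₐ[k] Aq k d :=
  Ideal.Quotient.liftₐ _ (aeval (Ideal.Quotient.mk _ (autPoly w α) : Aq k d)) <| by
    suffices Ideal.span {(X : k[X]) ^ (2 * d)} ≤
        RingHom.ker (aeval (Ideal.Quotient.mk _ (autPoly w α) : Aq k d)) from fun a ha => this ha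
    rw [Ideal.span_singleton_le_iff_mem, RingHom.mem_ker, map_pow, aeval_X,
      pow_mul' (Ideal.Quotient.mk _ _ : Aq k d),
      mk_autPoly_pow w hα, ← pow_mul' (ybar k d), ybar_pow_two_mul]

theorem autHom_ybar {k : Type*} [CommRing k] {d : ℕ} (w : Fin (d - 1) → k) {α : k}
    (hα : α ^ d = 1) : autHom w hα (ybar k d) = Ideal.Quotient.mk _ (autPoly w α) :=
  aeval_X _

theorem autHom_comp {k : Type*} [CommRing k] {d : ℕ} (w v : Fin (d - 1) → k) {α β : k}
    (hα : α ^ d = 1) (hβ : β ^ d = 1) (hαβ : (α * β) ^ d = 1) :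
    (autHom w hα).comp (autHom v hβ) =
      autHom (w + fun i : Fin (d - 1) => α ^ (i : ℕ) * v i) hαβ := by
  apply algHom_ext_ybar
  rw [AlgHom.comp_apply, autHom_ybar, autHom_ybar, mk_autPoly, mk_autPoly, map_add, map_sum,
    map_smul, autHom_ybar, mk_autPoly, smul_add, smul_smul, mul_comm β α, add_assoc,
    Finset.smul_sum, ← Finset.sum_add_distrib]
  congr 1
  refine Finset.sum_congr rfl fun i _ => ?_
  rw [map_smul, map_pow, autHom_ybar, add_assoc, mk_autPoly_pow_add w hα, smul_smul, smul_smul,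
    ← add_smul]
  congr 1
  simp only [Pi.add_apply]
  ring

theorem autHom_zero_one {k : Type*} [CommRing k] {d : ℕ} (h : (1 : k) ^ d = 1) :
    autHom (0 : Fin (d - 1) → k) h = AlgHom.id k (Aq k d) := by
  apply algHom_ext_ybar
  simp [autHom_ybar, mk_autPoly]

theorem autHom_comp_eq_id {k : Type*} [CommRing k] {d : ℕ} {w v : Fin (d - 1) → k} {α β : k}
    (hα : α ^ d = 1) (hβ : β ^ d = 1) (hαβ : α * β = 1)
    (hwv : ∀ i : Fin (d - 1), w i + α ^ (i : ℕ) * v i = 0) :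
    (autHom w hα).comp (autHom v hβ) = AlgHom.id k (Aq k d) := by
  rw [autHom_comp w v hα hβ (by rw [hαβ, one_pow]), ← autHom_zero_one (one_pow d)]
  congr 1
  exact funext hwv

/-- The automorphism of `k[y]/(y^(2d))` sending `ȳ` to the class of `autPoly w α`. -/
noncomputable def autEquiv {k : Type*} [Field k] {d : ℕ} (hd : 1 ≤ d) (w : Fin (d - 1) → k)
    {α : k} (hα : α ^ d = 1) : Aq k d ≃ₐ[k] Aq k d :=
  have hα0 : α ≠ 0 := by
    rintro rfl
    rw [zero_pow (by omega)] at hα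
    exact zero_ne_one hα
  have hα' : α⁻¹ ^ d = 1 := by rw [inv_pow, hα, inv_one]
  AlgEquiv.ofAlgHom (autHom w hα) (autHom (fun i => -(α⁻¹ ^ (i : ℕ) * w i)) hα')
    (autHom_comp_eq_id hα hα' (mul_inv_cancel₀ hα0) fun i => by
      rw [mul_neg, ← mul_assoc, ← mul_pow, mul_inv_cancel₀ hα0, one_pow, one_mul, add_neg_cancel])
    (autHom_comp_eq_id hα' hα (inv_mul_cancel₀ hα0) fun i => neg_add_cancel _)

theorem autEquiv_ybar {k : Type*} [Field k] {d : ℕ} (hd : 1 ≤ d) (w : Fin (d - 1) → k)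
    {α : k} (hα : α ^ d = 1) :
    autEquiv hd w hα (ybar k d) = Ideal.Quotient.mk _ (autPoly w α) :=
  autHom_ybar w hα

theorem algEquiv_ext_ybar {k : Type*} [CommRing k] {d : ℕ} {f g : Aq k d ≃ₐ[k] Aq k d}
    (h : f (ybar k d) = g (ybar k d)) : f = g :=
  AlgEquiv.coe_toAlgHom_injective (algHom_ext_ybar h)

theorem autPoly_mk_injective {k : Type*} [Field k] {d : ℕ} (hd : 1 ≤ d) {w v : Fin (d - 1) → k}
    {α β : k} (hα : α ≠ 0)
    (h : (Ideal.Quotient.mk _ (autPoly w α) : Aq k d) = Ideal.Quotient.mk _ (autPoly v β)) :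
    w = v ∧ α = β := by
  rw [mk_eq_mk_iff_coeff] at h
  have hαβ : α = β := by
    simpa only [coeff_one_autPoly hd] using h 1 (by omega)
  refine ⟨funext fun i => ?_, hαβ⟩
  have hi := h (d + 1 + i) (by omega)
  rw [coeff_add_autPoly hd, coeff_add_autPoly hd, ← hαβ] at hi
  exact mul_left_cancel₀ hα hi

theorem X_pow_dvd_sub_C_of_dvd_pow_sub_one {k : Type*} [Field k] {d n : ℕ} (hd : (d : k) ≠ 0)
    (hn : n ≠ 0) {f : k[X]} (h : X ^ n ∣ f ^ d - 1) :
    f.coeff 0 ^ d = 1 ∧ X ^ n ∣ f - C (f.coeff 0) := by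
  have hα : f.coeff 0 ^ d = 1 := by
    have := X_pow_dvd_iff.1 h 0 (Nat.pos_of_ne_zero hn)
    rwa [coeff_sub, coeff_zero_eq_eval_zero, eval_pow, ← coeff_zero_eq_eval_zero, coeff_one_zero,
      sub_eq_zero] at this
  have hd0 : d ≠ 0 := by rintro rfl; simp at hd
  have hα0 : f.coeff 0 ≠ 0 := by
    intro h0
    rw [h0, zero_pow hd0] at hα
    exact zero_ne_one hα
  refine ⟨hα, ?_⟩
  rw [← C_1, ← hα, C_pow, ← (Commute.all f (C (f.coeff 0))).geom_sum₂_mul] at h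
  refine prime_X.pow_dvd_of_dvd_mul_left n (fun hX => ?_) h
  rw [X_dvd_iff, coeff_zero_eq_eval_zero, ← coe_evalRingHom, RingHom.map_geom_sum₂,
    coe_evalRingHom, eval_C, ← coeff_zero_eq_eval_zero, geom_sum₂_self] at hX
  exact mul_ne_zero hd (pow_ne_zero _ hα0) hX

theorem exists_mk_autPoly_of_pow_eq {k : Type*} [Field k] {d : ℕ} (hd : (d : k) ≠ 0)
    {u : Aq k d} (hu : u ^ d = ybar k d ^ d) :
    ∃ (w : Fin (d - 1) → k) (α : k), α ^ d = 1 ∧ Ideal.Quotient.mk _ (autPoly w α) = u := by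
  have hd0 : d ≠ 0 := by rintro rfl; simp at hd
  obtain ⟨p, rfl⟩ := Ideal.Quotient.mk_surjective u
  rw [← map_pow, ← map_pow, Ideal.Quotient.eq, Ideal.mem_span_singleton] at hu
  have hX : X ∣ p := by
    refine prime_X.dvd_of_dvd_pow (n := d) ?_
    rw [← dvd_sub_left (dvd_pow_self X hd0)]
    exact (dvd_pow_self X (by omega)).trans hu
  obtain ⟨f, rfl⟩ := hX
  have hf : X ^ d ∣ f ^ d - 1 := by
    rw [mul_pow, two_mul, pow_add,
      show (X : k[X]) ^ d * f ^ d - X ^ d = X ^ d * (f ^ d - 1) by ring] at hu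
    exact (mul_dvd_mul_iff_left (pow_ne_zero d X_ne_zero)).1 hu
  obtain ⟨hα, hdvd⟩ := X_pow_dvd_sub_C_of_dvd_pow_sub_one hd hd0 hf
  have hα0 : f.coeff 0 ≠ 0 := by
    intro h0
    rw [h0, zero_pow hd0] at hα
    exact zero_ne_one hα
  refine ⟨fun i => (f.coeff 0)⁻¹ * f.coeff (d + i), f.coeff 0, hα, mk_eq_mk_iff_coeff.2 ?_⟩
  intro n hn
  rcases n with _ | n
  · rw [coeff_autPoly_of_le _ _ (Nat.zero_le d) zero_ne_one, coeff_X_mul_zero]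
  rw [coeff_X_mul]
  rcases Nat.eq_zero_or_pos n with rfl | hn0
  · rw [zero_add, coeff_one_autPoly (by omega)]
  rcases lt_or_ge n d with hnd | hnd
  · have := X_pow_dvd_iff.1 hdvd n hnd
    rw [coeff_sub, coeff_C_of_ne_zero hn0.ne', sub_zero] at this
    rw [coeff_autPoly_of_le _ _ hnd (by omega), this]
  · obtain ⟨j, rfl⟩ := Nat.exists_eq_add_of_le hnd
    have := coeff_add_autPoly (by omega) (fun i : Fin (d - 1) => (f.coeff 0)⁻¹ * f.coeff (d + i))
      (f.coeff 0) ⟨j, by omega⟩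
    rw [add_right_comm, this, mul_inv_cancel_left₀ hα0]

/-- The group of `k`-algebra automorphisms of `A = k[y]/(y^(2d))` fixing `ȳ^d` is
isomorphic to the semidirect product `k^(d-1) ⋊ μ_d(k)`, where `μ_d(k) = {α : α^d = 1}`
acts on the additive group `k^(d-1)` by `(α • w)_i = α^(i-1) * w_i` (1-based indexing),
via the isomorphism sending `(w, α)` to the automorphism
`ȳ ↦ α ȳ + ∑_{i=1}^{d-1} α w_i ȳ^(d+i)`.  The multiplicativity condition is stated
using the semidirect product law `(w, α) * (v, β) = (w + α • v, α β)`. -/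
theorem single_component_auts_semidirect (k : Type*) [Field k] (d : ℕ) (hd : 1 ≤ d)
    (hfact : (Nat.factorial d : k) ≠ 0) :
    ∃ e : ((Fin (d - 1) → k) × {α : k // α ^ d = 1}) ≃
        {φ : Aq k d ≃ₐ[k] Aq k d // φ (ybar k d ^ d) = ybar k d ^ d},
      (∀ (w : Fin (d - 1) → k) (α : {α : k // α ^ d = 1}),
        (e (w, α)).1 (ybar k d) =
          α.1 • ybar k d +
            ∑ i : Fin (d - 1), (α.1 * w i) • ybar k d ^ (d + 1 + (i : ℕ)))
      ∧ (∀ (w v : Fin (d - 1) → k) (α β : {α : k // α ^ d = 1}),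
          (e (w + fun i : Fin (d - 1) => α.1 ^ (i : ℕ) * v i,
              ⟨α.1 * β.1, by rw [mul_pow, α.2, β.2, one_mul]⟩)).1 =
            (e (w, α)).1 * (e (v, β)).1) := by
  have hdk : (d : k) ≠ 0 := fun h => hfact <| by
    obtain ⟨m, hm⟩ := Nat.dvd_factorial hd le_rfl
    rw [hm, Nat.cast_mul, h, zero_mul]
  let E (x : (Fin (d - 1) → k) × {α : k // α ^ d = 1}) :
      {φ : Aq k d ≃ₐ[k] Aq k d // φ (ybar k d ^ d) = ybar k d ^ d} :=
    ⟨autEquiv hd x.1 x.2.2, by rw [map_pow, autEquiv_ybar, mk_autPoly_pow x.1 x.2.2]⟩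
  have hE : Function.Bijective E := by
    constructor
    · rintro ⟨w, α, hα⟩ ⟨v, β, hβ⟩ h
      have hy := congrArg (fun φ => φ.1 (ybar k d)) h
      simp only [E, autEquiv_ybar] at hy
      have hα0 : α ≠ 0 := by
        rintro rfl
        rw [zero_pow (by omega)] at hα
        exact zero_ne_one hα
      obtain ⟨rfl, rfl⟩ := autPoly_mk_injective hd hα0 hy
      rfl
    · rintro ⟨φ, hφ⟩
      obtain ⟨w, α, hα, h⟩ := exists_mk_autPoly_of_pow_eq hdk ((map_pow φ _ _).symm.trans hφ)
      exact ⟨(w, ⟨α, hα⟩), Subtype.ext (algEquiv_ext_ybar ((autEquiv_ybar hd w hα).trans h))⟩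
  refine ⟨Equiv.ofBijective E hE, fun w α => ?_, fun w v α β => ?_⟩
  · exact (autEquiv_ybar hd w α.2).trans (mk_autPoly w α.1)
  · exact AlgEquiv.coe_toAlgHom_injective
      (autHom_comp w v α.2 β.2 (by rw [mul_pow, α.2, β.2, one_mul])).symm
end

section
/- Let k be a commutative ring and d ≥ 1 an integer. Let A := k[y]/(y^{2d}), the quotient of the polynomial ring k[y] by the ideal generated by y^{2d}, and let ȳ denote the image of y in A. Let α ∈ k satisfy α^d = 1 and let a_1, …, a_{d−1} ∈ k. Set u := α·ȳ + Σ_{i=1}^{d−1} a_i·ȳ^{d+i} ∈ A. Then u^d = ȳ^d, there is a unique k-algebra endomorphism φ of A with φ(ȳ) = u, and this φ is a k-algebra automorphism of A. -/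
open Polynomial

section TruncatedPerturbation

variable {k B : Type*} [CommRing k] [CommRing B] [Algebra k B] {d : ℕ} {α : k} {y : B}

theorem smul_add_pow_mul_pow_eq (hα : α ^ d = 1) (hy : y ^ (2 * d) = 0) (z : B) :
    (α • y + y ^ (d + 1) * z) ^ d = y ^ d := by
  obtain ⟨w, hw⟩ := sub_dvd_pow_sub_pow (algebraMap k B α + y ^ d * z) (algebraMap k B α) d
  rw [← map_pow, hα, map_one, add_sub_cancel_left, sub_eq_iff_eq_add] at hw
  have hu : α • y + y ^ (d + 1) * z = y * (algebraMap k B α + y ^ d * z) := by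
    rw [Algebra.smul_def]; ring
  rw [hu, mul_pow, hw]
  linear_combination (z * w) * hy

theorem pow_mul_smul_add_pow_mul (hy : y ^ (2 * d) = 0) (z : B) :
    y ^ d * (α • y + y ^ (d + 1) * z) = α • y ^ (d + 1) := by
  simp only [Algebra.smul_def]
  linear_combination (y * z) * hy

theorem pow_add_mem_of_smul_add_mem (hd : 1 ≤ d) (hα : α ^ d = 1) (hy : y ^ (2 * d) = 0) {z : B}
    {S : Subalgebra k B} (hS : α • y + y ^ (d + 1) * z ∈ S) (n : ℕ) : y ^ (d + n) ∈ S := by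
  induction n with
  | zero =>
    rw [add_zero, ← smul_add_pow_mul_pow_eq hα hy z]
    exact S.pow_mem hS d
  | succ n ih =>
    have h : y ^ (d + (n + 1)) =
        α ^ (d - 1) • (y ^ (d + n) * (α • y + y ^ (d + 1) * z)) := by
      rw [pow_add y d n, mul_right_comm, pow_mul_smul_add_pow_mul hy, smul_mul_assoc, smul_smul,
        ← pow_succ, Nat.sub_add_cancel hd, hα, one_smul]
      ring
    rw [h]
    exact S.smul_mem (S.mul_mem ih hS) _

end TruncatedPerturbation

theorem Aq.algHom_ext {k B : Type*} [CommRing k] [Semiring B] [Algebra k B] {d : ℕ}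
    {φ ψ : Aq k d →ₐ[k] B} (h : φ (ybar k d) = ψ (ybar k d)) : φ = ψ :=
  Ideal.Quotient.algHom_ext _ (Polynomial.algHom_ext h)

theorem Aq.exists_algHom {k B : Type*} [CommRing k] [CommRing B] [Algebra k B] {d : ℕ} {u : B}
    (hu : u ^ (2 * d) = 0) : ∃ φ : Aq k d →ₐ[k] B, φ (ybar k d) = u := by
  refine ⟨Ideal.Quotient.liftₐ _ (aeval u) fun p hp => ?_, aeval_X u⟩
  obtain ⟨q, rfl⟩ := Ideal.mem_span_singleton.mp hp
  rw [map_mul, map_pow, aeval_X, hu, zero_mul]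

theorem Aq.subalgebra_eq_top {k : Type*} [CommRing k] {d : ℕ} {S : Subalgebra k (Aq k d)}
    (h : ybar k d ∈ S) : S = ⊤ := by
  rw [eq_top_iff]
  rintro x -
  obtain ⟨p, rfl⟩ := Ideal.Quotient.mk_surjective x
  have hp : aeval (ybar k d) p = Ideal.Quotient.mk _ p := by
    have := aeval_algHom_apply (Ideal.Quotient.mkₐ k (Ideal.span {(X : k[X]) ^ (2 * d)})) X p
    rwa [aeval_X_left_apply] at this
  rw [← hp]
  exact Algebra.adjoin_le (Set.singleton_subset_iff.mpr h) (aeval_mem_adjoin_singleton k _)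

instance Aq.finite (k : Type*) [CommRing k] (d : ℕ) : Module.Finite k (Aq k d) :=
  (monic_X_pow (2 * d)).finite_quotient

/-- If `α^d = 1` and `u = α ȳ + ∑_{i=1}^{d-1} a_i ȳ^(d+i)` in `A = k[y]/(y^(2d))`, then
`u^d = ȳ^d`, there is a unique `k`-algebra endomorphism `φ` of `A` with `φ(ȳ) = u`, and
any such `φ` is an automorphism (i.e. bijective). -/
theorem phi_alpha_a_well_defined (k : Type*) [CommRing k] (d : ℕ) (hd : 1 ≤ d)
    (α : k) (hα : α ^ d = 1) (a : Fin (d - 1) → k) :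
    (α • ybar k d + ∑ i : Fin (d - 1), a i • ybar k d ^ (d + 1 + (i : ℕ))) ^ d
        = ybar k d ^ d
    ∧ (∃! φ : Aq k d →ₐ[k] Aq k d,
        φ (ybar k d) =
          α • ybar k d + ∑ i : Fin (d - 1), a i • ybar k d ^ (d + 1 + (i : ℕ)))
    ∧ ∀ φ : Aq k d →ₐ[k] Aq k d,
        φ (ybar k d) =
          α • ybar k d + ∑ i : Fin (d - 1), a i • ybar k d ^ (d + 1 + (i : ℕ)) →
        Function.Bijective φ := by
  have hy := ybar_pow_two_mul k d
  have hsum : ∑ i : Fin (d - 1), a i • ybar k d ^ (d + 1 + (i : ℕ)) =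
      ybar k d ^ (d + 1) * ∑ i : Fin (d - 1), a i • ybar k d ^ (i : ℕ) := by
    simp only [Finset.mul_sum, mul_smul_comm, pow_add]
  rw [hsum]
  set z := ∑ i : Fin (d - 1), a i • ybar k d ^ (i : ℕ)
  have hpow := smul_add_pow_mul_pow_eq hα hy z
  refine ⟨hpow, ?_, fun φ hφ => ?_⟩
  · obtain ⟨φ, hφ⟩ := Aq.exists_algHom (k := k) (d := d)
      (u := α • ybar k d + ybar k d ^ (d + 1) * z)
      (by rw [pow_mul', hpow, ← pow_mul', hy])
    exact ⟨φ, hφ, fun ψ hψ => Aq.algHom_ext (hψ.trans hφ.symm)⟩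
  · have hu : α • ybar k d + ybar k d ^ (d + 1) * z ∈ φ.range := ⟨ybar k d, hφ⟩
    have hmem := pow_add_mem_of_smul_add_mem hd hα hy hu
    have htail : ybar k d ^ (d + 1) * z ∈ φ.range := by
      rw [← hsum]
      exact sum_mem fun i _ => φ.range.smul_mem (by rw [add_assoc]; exact hmem _) _
    have hαy : α • ybar k d ∈ φ.range := by
      simpa using φ.range.sub_mem hu htail
    have hybar : ybar k d ∈ φ.range := by
      have := φ.range.smul_mem hαy (α ^ (d - 1))
      rwa [smul_smul, ← pow_succ, Nat.sub_add_cancel hd, hα, one_smul] at this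
    have hsurj : Function.Surjective φ :=
      (AlgHom.range_eq_top φ).mp (Aq.subalgebra_eq_top hybar)
    exact ⟨OrzechProperty.injective_of_surjective_endomorphism φ.toLinearMap hsurj, hsurj⟩
end

section
/- Let k be a commutative ring and d ≥ 1 an integer. Let A := k[y]/(y^{2d}), the quotient of the polynomial ring k[y] by the ideal generated by y^{2d}, and let ȳ denote the image of y in A. For α ∈ k with α^d = 1 (so α is a unit) and a = (a_1,…,a_{d−1}) ∈ k^{d−1}, let φ_{α,a} denote the k-algebra automorphism of A determined by φ_{α,a}(ȳ) = α·ȳ + Σ_{i=1}^{d−1} a_i·ȳ^{d+i}. Then for all such pairs (α,a) and (β,b): φ_{α,a} ∘ φ_{β,b} = φ_{αβ, c}, where c_i = β·a_i + α^i·b_i for 1 ≤ i ≤ d−1. In particular, the inverse of φ_{α,a} is φ_{α^{−1}, b}, where α^{−1} is the inverse of α in k and b_i = −α^{−(i+1)}·a_i. -/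
open Polynomial

theorem ybar_pow_eq_zero (k : Type*) [CommRing k] (d : ℕ) {n : ℕ} (hn : 2 * d ≤ n) :
    ybar k d ^ n = 0 := by
  rw [ybar, ← map_pow, Ideal.Quotient.eq_zero_iff_mem]
  exact Ideal.mem_span_singleton.2 (pow_dvd_pow _ hn)

theorem aq_algEquiv_ext {k : Type*} [CommRing k] {d : ℕ} {φ ψ : Aq k d ≃ₐ[k] Aq k d}
    (h : φ (ybar k d) = ψ (ybar k d)) : φ = ψ := by
  have h_hom : (φ : Aq k d →ₐ[k] Aq k d) = ψ :=
    Ideal.Quotient.algHom_ext _ (Polynomial.algHom_ext h)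
  ext x
  exact DFunLike.congr_fun h_hom x

theorem smul_ybar_add_sum_pow {k : Type*} [CommRing k] {d : ℕ} (α : k)
    (a : Fin (d - 1) → k) {n : ℕ} (hn : d ≤ n) :
    (α • ybar k d + ∑ i : Fin (d - 1), a i • ybar k d ^ (d + 1 + (i : ℕ))) ^ n =
      α ^ n • ybar k d ^ n := by
  set y := ybar k d
  set c := algebraMap k (Aq k d) α
  set s := ∑ i : Fin (d - 1), a i • y ^ (i : ℕ)
  have h_smul (r : k) (x : Aq k d) : r • x = algebraMap k (Aq k d) r * x :=
    Algebra.smul_def r x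
  have h_factor : α • y + ∑ i : Fin (d - 1), a i • y ^ (d + 1 + (i : ℕ)) =
      y * (c + y ^ d * s) := by
    simp only [s, c, mul_add, Finset.mul_sum, h_smul]
    congr 1
    · ring
    · exact Finset.sum_congr rfl fun i _ => by ring
  obtain ⟨t, ht⟩ : y ^ d ∣ (c + y ^ d * s) ^ n - c ^ n :=
    (Dvd.intro s (by ring : y ^ d * s = c + y ^ d * s - c)).trans (sub_dvd_pow_sub_pow _ _ n)
  have h_zero : y ^ n * y ^ d = 0 := by
    rw [← pow_add]
    exact ybar_pow_eq_zero k d (by lia)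
  rw [h_factor, mul_pow, h_smul, map_pow]
  linear_combination y ^ n * ht + t * h_zero

theorem algEquiv_smul_ybar_add_sum {k : Type*} [CommRing k] {d : ℕ} {α : k}
    (hα : α ^ d = 1) (β : k) (a b : Fin (d - 1) → k) (φ : Aq k d ≃ₐ[k] Aq k d)
    (hφ : φ (ybar k d) =
      α • ybar k d + ∑ i : Fin (d - 1), a i • ybar k d ^ (d + 1 + (i : ℕ))) :
    φ (β • ybar k d + ∑ i : Fin (d - 1), b i • ybar k d ^ (d + 1 + (i : ℕ))) =
      (α * β) • ybar k d + ∑ i : Fin (d - 1),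
        (β * a i + α ^ ((i : ℕ) + 1) * b i) • ybar k d ^ (d + 1 + (i : ℕ)) := by
  have h_pow (i : Fin (d - 1)) : φ (ybar k d) ^ (d + 1 + (i : ℕ)) =
      α ^ ((i : ℕ) + 1) • ybar k d ^ (d + 1 + (i : ℕ)) := by
    rw [hφ, smul_ybar_add_sum_pow α a (by lia), add_assoc, pow_add α, hα, one_mul,
      add_comm 1 (i : ℕ)]
  simp only [map_add, map_sum, map_smul, map_pow, h_pow]
  rw [hφ, smul_add, Finset.smul_sum, add_assoc, ← Finset.sum_add_distrib, smul_smul,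
    mul_comm β α]
  simp only [smul_smul, add_smul, mul_comm (b _)]

/-- Composition law for the automorphisms `φ_{α,a} : ȳ ↦ α ȳ + ∑_{i=1}^{d-1} a_i ȳ^(d+i)`
of `A = k[y]/(y^(2d))` (with `α` a unit satisfying `α^d = 1`):
`φ_{α,a} ∘ φ_{β,b} = φ_{αβ, c}` with `c_i = β a_i + α^i b_i`, and
`φ_{α,a}⁻¹ = φ_{α⁻¹, b}` with `b_i = -α^{-(i+1)} a_i`.  (Here `φ_{αβ,c}` resp.
`φ_{α⁻¹,b}` is characterized among automorphisms by its value on `ȳ`.) -/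
theorem phi_alpha_a_composition (k : Type*) [CommRing k] (d : ℕ) (hd : 1 ≤ d)
    (α β : kˣ) (hα : (α : k) ^ d = 1) (hβ : (β : k) ^ d = 1)
    (a b : Fin (d - 1) → k)
    (φ ψ : Aq k d ≃ₐ[k] Aq k d)
    (hφ : φ (ybar k d) =
      (α : k) • ybar k d + ∑ i : Fin (d - 1), a i • ybar k d ^ (d + 1 + (i : ℕ)))
    (hψ : ψ (ybar k d) =
      (β : k) • ybar k d + ∑ i : Fin (d - 1), b i • ybar k d ^ (d + 1 + (i : ℕ))) :
    (∀ χ : Aq k d ≃ₐ[k] Aq k d,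
      (χ (ybar k d) = ((α : k) * (β : k)) • ybar k d +
          ∑ i : Fin (d - 1),
            ((β : k) * a i + (α : k) ^ ((i : ℕ) + 1) * b i) •
              ybar k d ^ (d + 1 + (i : ℕ)))
        ↔ φ * ψ = χ)
    ∧ (∀ χ : Aq k d ≃ₐ[k] Aq k d,
      (χ (ybar k d) = ((α⁻¹ : kˣ) : k) • ybar k d +
          ∑ i : Fin (d - 1),
            (-(((α⁻¹ : kˣ) : k) ^ ((i : ℕ) + 2) * a i)) •
              ybar k d ^ (d + 1 + (i : ℕ)))
        ↔ φ⁻¹ = χ) := by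
  have h_ext (σ τ : Aq k d ≃ₐ[k] Aq k d) : σ (ybar k d) = τ (ybar k d) ↔ σ = τ :=
    ⟨aq_algEquiv_ext, fun h => by rw [h]⟩
  refine ⟨fun χ => ?_, fun χ => ?_⟩
  · rw [← algEquiv_smul_ybar_add_sum hα (β : k) a b φ hφ, ← hψ, ← AlgEquiv.mul_apply, h_ext,
      eq_comm]
  · have h_inv (i : Fin (d - 1)) : ((α⁻¹ : kˣ) : k) * a i +
        (α : k) ^ ((i : ℕ) + 1) * -(((α⁻¹ : kˣ) : k) ^ ((i : ℕ) + 2) * a i) = 0 := by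
      have h_one : (α : k) ^ ((i : ℕ) + 1) * ((α⁻¹ : kˣ) : k) ^ ((i : ℕ) + 1) = 1 := by
        rw [← mul_pow, Units.mul_inv, one_pow]
      linear_combination -(((α⁻¹ : kˣ) : k) * a i) * h_one
    have h_image := algEquiv_smul_ybar_add_sum hα ((α⁻¹ : kˣ) : k) a
      (fun i => -(((α⁻¹ : kˣ) : k) ^ ((i : ℕ) + 2) * a i)) φ hφ
    simp only [h_inv, zero_smul, Finset.sum_const_zero, add_zero, Units.mul_inv, one_smul]
      at h_image
    rw [← φ.injective.eq_iff, h_image, ← AlgEquiv.mul_apply, inv_eq_iff_mul_eq_one]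
    exact h_ext (φ * χ) 1
end

section
/- Let R be a commutative ring and let G := GL₃(R) × GL₂(R). (i) For every (M, N) ∈ G there is a unique unit λ ∈ Rˣ such that det(λ·M) = det(λ²·N), namely λ = det(M)·det(N)^{−1}. (ii) Let Z ≤ G be the image of the group homomorphism Rˣ → G, λ ↦ (λ·I₃, λ²·I₂) (a central, hence normal, subgroup), and let K ≤ G be the subgroup of pairs (M, N) with det M = det N. Then the composite of the inclusion K ↪ G with the quotient map G → G/Z is an isomorphism of groups K ≅ G/Z. -/
open Matrix

/-- The homomorphism `Rˣ → GL_n(R)`, `λ ↦ λ·Iₙ`. -/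
noncomputable def scalarUnitsHom (n : ℕ) (R : Type*) [CommRing R] :
    Rˣ →* GL (Fin n) R :=
  Units.map (algebraMap R (Matrix (Fin n) (Fin n) R)).toMonoidHom

/-- The homomorphism `Rˣ → GL₃(R) × GL₂(R)`, `λ ↦ (λ·I₃, λ²·I₂)`. -/
noncomputable def zHom5 (R : Type*) [CommRing R] :
    Rˣ →* GL (Fin 3) R × GL (Fin 2) R :=
  MonoidHom.prod (scalarUnitsHom 3 R) ((scalarUnitsHom 2 R).comp (powMonoidHom 2))

/-- The subgroup `Z ≤ GL₃(R) × GL₂(R)`, the image of `λ ↦ (λ·I₃, λ²·I₂)`. -/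
noncomputable def Zsub5 (R : Type*) [CommRing R] :
    Subgroup (GL (Fin 3) R × GL (Fin 2) R) :=
  (zHom5 R).range

/-- The subgroup `K ≤ GL₃(R) × GL₂(R)` of pairs `(M, N)` with `det M = det N`. -/
def Ksub5 (R : Type*) [CommRing R] : Subgroup (GL (Fin 3) R × GL (Fin 2) R) where
  carrier := {p | Matrix.GeneralLinearGroup.det p.1 = Matrix.GeneralLinearGroup.det p.2}
  one_mem' := by simp
  mul_mem' := by
    intro p q hp hq
    simp only [Set.mem_setOf_eq, Prod.fst_mul, Prod.snd_mul, _root_.map_mul] at *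
    rw [hp, hq]
  inv_mem' := by
    intro p hp
    simp only [Set.mem_setOf_eq, Prod.fst_inv, Prod.snd_inv, _root_.map_inv] at *
    rw [hp]

instance Zsub5.normal (R : Type*) [CommRing R] : (Zsub5 R).Normal := by
  constructor
  rintro x ⟨l, rfl⟩ g
  refine ⟨l, ?_⟩
  have h1 : g.1 * (zHom5 R l).1 = (zHom5 R l).1 * g.1 := by
    apply Units.ext
    simp only [Units.val_mul, zHom5, scalarUnitsHom, MonoidHom.prod_apply,
      RingHom.toMonoidHom_eq_coe, Units.coe_map, MonoidHom.coe_coe]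
    exact (Algebra.commutes _ _).symm
  have h2 : g.2 * (zHom5 R l).2 = (zHom5 R l).2 * g.2 := by
    apply Units.ext
    simp only [Units.val_mul, zHom5, scalarUnitsHom, MonoidHom.prod_apply,
      MonoidHom.comp_apply, RingHom.toMonoidHom_eq_coe, Units.coe_map, MonoidHom.coe_coe]
    exact (Algebra.commutes _ _).symm
  have hc : g * zHom5 R l = zHom5 R l * g := Prod.ext h1 h2
  rw [hc, mul_assoc, mul_inv_cancel, mul_one]

theorem coe_scalarUnitsHom (n : ℕ) {R : Type*} [CommRing R] (u : Rˣ) :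
    (scalarUnitsHom n R u : Matrix (Fin n) (Fin n) R) = algebraMap R _ (u : R) :=
  rfl

theorem det_scalarUnitsHom (n : ℕ) {R : Type*} [CommRing R] (u : Rˣ) :
    Matrix.GeneralLinearGroup.det (scalarUnitsHom n R u) = u ^ n := by
  ext
  simp [coe_scalarUnitsHom, Matrix.algebraMap_eq_diagonal]

theorem det_zHom5_fst {R : Type*} [CommRing R] (u : Rˣ) :
    Matrix.GeneralLinearGroup.det (zHom5 R u).1 = u ^ 3 :=
  det_scalarUnitsHom 3 u

theorem det_zHom5_snd {R : Type*} [CommRing R] (u : Rˣ) :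
    Matrix.GeneralLinearGroup.det (zHom5 R u).2 = u ^ 4 := by
  rw [zHom5, MonoidHom.prod_apply, MonoidHom.comp_apply, powMonoidHom_apply, det_scalarUnitsHom,
    ← pow_mul]

theorem mem_Ksub5 {R : Type*} [CommRing R] {p : GL (Fin 3) R × GL (Fin 2) R} :
    p ∈ Ksub5 R ↔
      Matrix.GeneralLinearGroup.det p.1 = Matrix.GeneralLinearGroup.det p.2 :=
  Iff.rfl

theorem pow_three_mul_eq_pow_four_mul_iff {G : Type*} [CommGroup G] (u a b : G) :
    u ^ 3 * a = u ^ 4 * b ↔ u = a * b⁻¹ := by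
  rw [pow_succ u 3, mul_assoc, mul_right_inj, eq_mul_inv_iff_mul_eq, eq_comm]

theorem zHom5_mul_mem_Ksub5_iff {R : Type*} [CommRing R] (u : Rˣ)
    (p : GL (Fin 3) R × GL (Fin 2) R) :
    zHom5 R u * p ∈ Ksub5 R ↔
      u = Matrix.GeneralLinearGroup.det p.1 * (Matrix.GeneralLinearGroup.det p.2)⁻¹ := by
  rw [mem_Ksub5, Prod.fst_mul, Prod.snd_mul, _root_.map_mul, _root_.map_mul, det_zHom5_fst,
    det_zHom5_snd, pow_three_mul_eq_pow_four_mul_iff]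

theorem Zsub5_le_center (R : Type*) [CommRing R] :
    Zsub5 R ≤ Subgroup.center (GL (Fin 3) R × GL (Fin 2) R) := by
  rintro _ ⟨u, rfl⟩
  rw [Subgroup.mem_center_iff]
  exact fun g => Prod.ext (Units.ext (Algebra.commutes _ _).symm)
    (Units.ext (Algebra.commutes _ _).symm)

/-- Statement (i) and (ii) of the degree-4 case of the lemma: for `(M, N) ∈ GL₃(R) × GL₂(R)`
there is a unique unit `λ` with `det(λM) = det(λ²N)`, namely `λ = det M · (det N)⁻¹`; the
subgroup `Z` (image of `λ ↦ (λI₃, λ²I₂)`) is central, and the composite of the inclusion of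
`K = {(M,N) : det M = det N}` with the quotient map `G → G/Z` is an isomorphism. -/
theorem aut_as_sub_deg4 (R : Type*) [CommRing R] :
    (∀ (M : GL (Fin 3) R) (N : GL (Fin 2) R) (lam : Rˣ),
      ((lam : R) • (M : Matrix (Fin 3) (Fin 3) R)).det
          = (((lam : R) ^ 2) • (N : Matrix (Fin 2) (Fin 2) R)).det
        ↔ lam = Matrix.GeneralLinearGroup.det M * (Matrix.GeneralLinearGroup.det N)⁻¹)
    ∧ Zsub5 R ≤ Subgroup.center (GL (Fin 3) R × GL (Fin 2) R)
    ∧ Function.Bijective ((QuotientGroup.mk' (Zsub5 R)).comp (Ksub5 R).subtype) := by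
  refine ⟨fun M N lam => ?_, Zsub5_le_center R, ?_, ?_⟩
  · rw [← pow_three_mul_eq_pow_four_mul_iff, ← Units.val_inj]
    simp [← pow_mul]
  · rw [injective_iff_map_eq_one]
    rintro ⟨p, hp⟩ h
    obtain ⟨u, rfl⟩ : p ∈ Zsub5 R := (QuotientGroup.eq_one_iff p).mp h
    have hu : u = 1 := by
      simpa using (zHom5_mul_mem_Ksub5_iff u 1).mp (by simpa using hp)
    subst hu
    exact Subtype.ext (_root_.map_one _)
  · intro q
    obtain ⟨p, rfl⟩ := QuotientGroup.mk'_surjective _ q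
    refine ⟨⟨_, (zHom5_mul_mem_Ksub5_iff _ p).mpr rfl⟩, ?_⟩
    have hz (u : Rˣ) : QuotientGroup.mk' (Zsub5 R) (zHom5 R u) = 1 :=
      (QuotientGroup.eq_one_iff _).mpr ⟨u, rfl⟩
    rw [MonoidHom.comp_apply, Subgroup.subtype_apply, _root_.map_mul, hz, one_mul]
end

section
/- Let d ∈ {2, 3, 4, 5} and let G be a subgroup of the symmetric group S_d (the group of all permutations of a set with d elements) such that the induced action of G on the d-element set is transitive and G contains a transposition (a permutation exchanging two elements and fixing all others). Then either G = S_d, or d = 4 and G has order 8 (so G is a Sylow 2-subgroup of S₄, a dihedral group of order 8). -/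
open MulAction in
/-- The order of a transitive permutation group on `α` which contains a transposition fixing a
point is divisible by twice the cardinality of `α`. -/
theorem card_mul_two_dvd_card_of_isSwap_mem {α : Type*} [Finite α] [DecidableEq α]
    (G : Subgroup (Equiv.Perm α)) [IsPretransitive G α] {g : Equiv.Perm α} (hg : g ∈ G)
    (hswap : g.IsSwap) {z : α} (hz : g z = z) : Nat.card α * 2 ∣ Nat.card G := by
  have := Fintype.ofFinite α
  rw [← (stabilizer G z).index_mul_card, index_stabilizer_of_transitive]
  refine mul_dvd_mul_left _ ?_
  let s : stabilizer G z := ⟨⟨g, hg⟩, hz⟩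
  have hs : orderOf s = 2 := by
    rw [← hswap.orderOf, ← Subgroup.orderOf_coe, ← Subgroup.orderOf_coe]
  exact hs ▸ orderOf_dvd_natCard s

theorem Equiv.Perm.IsSwap.exists_apply_eq_self {α : Type*} [Fintype α] [DecidableEq α]
    {g : Equiv.Perm α} (hg : g.IsSwap) (hα : 2 < Fintype.card α) : ∃ z, g z = z := by
  obtain ⟨z, hz⟩ := Finset.exists_mem_notMem_of_card_lt_card
    (s := g.support) (t := Finset.univ) (by rwa [card_support_eq_two.mpr hg])
  exact ⟨z, notMem_support.mp hz.2⟩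

/-- For `d ∈ {2,3,4,5}`, a subgroup `G` of the symmetric group `S_d` acting transitively on
the `d` points and containing a transposition is either all of `S_d`, or `d = 4` and `G` has
order `8` (a Sylow `2`-subgroup of `S₄`, dihedral of order `8`). -/
theorem transitive_subgroup_with_transposition (d : ℕ) (hd : d ∈ ({2, 3, 4, 5} : Set ℕ))
    (G : Subgroup (Equiv.Perm (Fin d)))
    (htrans : ∀ x y : Fin d, ∃ σ ∈ G, σ x = y)
    (hswap : ∃ σ ∈ G, Equiv.Perm.IsSwap σ) :
    G = ⊤ ∨ (d = 4 ∧ Nat.card G = 8) := by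
  obtain ⟨g, hg, hgs⟩ := hswap
  have : MulAction.IsPretransitive G (Fin d) := ⟨fun x y ↦ by
    obtain ⟨σ, hσ, h⟩ := htrans x y
    exact ⟨⟨σ, hσ⟩, h⟩⟩
  have of_prime (hp : d.Prime) : G = ⊤ :=
    Equiv.Perm.subgroup_eq_top_of_isPreprimitive_of_isSwap_mem
      (MulAction.IsPreprimitive.of_prime_card (by simpa using hp)) g hgs hg
  rcases hd with rfl | rfl | rfl | rfl
  · exact .inl (of_prime Nat.prime_two)
  · exact .inl (of_prime Nat.prime_three)
  · obtain ⟨z, hz⟩ := hgs.exists_apply_eq_self (by simp)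
    obtain ⟨k, hk⟩ := card_mul_two_dvd_card_of_isSwap_mem G hg hgs hz
    have hcard := G.card_mul_index
    rw [Nat.card_perm, Nat.card_fin, show Nat.factorial 4 = 24 from rfl, hk, Nat.card_fin] at hcard
    rw [Nat.card_fin] at hk
    have hk3 : k * G.index = 3 := by linarith
    rcases (Nat.dvd_prime Nat.prime_three).mp ⟨_, hk3.symm⟩ with rfl | rfl
    · exact .inr ⟨rfl, hk⟩
    · exact .inl (Subgroup.index_eq_one.mp (by omega))
  · exact .inl (of_prime Nat.prime_five)
end

section
/- Let k be an infinite field and let A be a commutative k-algebra that is finite-dimensional as a k-vector space, with dim_k A ≥ 2. Let η : A → k be a surjective k-linear map such that the only ideal of A contained in the kernel of η is the zero ideal. Then there exists an element a ∈ ker η that is a unit of A; equivalently, ker η is not contained in the union of the maximal ideals of A. -/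
/-- Over a field, an ideal containing the kernel of a linear functional that is not itself
contained in that kernel is the whole algebra. -/
theorem Ideal.eq_top_of_ker_le_of_apply_ne_zero {k A : Type*} [Field k] [CommRing A]
    [Algebra k A] (η : A →ₗ[k] k) (I : Ideal A) (hI : ∀ x, η x = 0 → x ∈ I)
    {x : A} (hx : x ∈ I) (hηx : η x ≠ 0) : I = ⊤ := by
  rw [Ideal.eq_top_iff_one]
  have h : (1 : A) - (η 1 / η x) • x ∈ I := hI _ (by simp [hηx])
  simpa using I.add_mem h (Submodule.smul_of_tower_mem I (η 1 / η x) hx)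

/-- Over an infinite field, a subspace covered by the maximal ideals of a finite-dimensional
commutative algebra lies in one of them. -/
theorem Submodule.exists_isMaximal_of_subset_iUnion {k A : Type*} [Field k] [Infinite k]
    [CommRing A] [Algebra k A] [FiniteDimensional k A] (V : Submodule k A)
    (hV : ∀ x ∈ V, ∃ m : Ideal A, m.IsMaximal ∧ x ∈ m) :
    ∃ m : Ideal A, m.IsMaximal ∧ ∀ x ∈ V, x ∈ m := by
  have : IsArtinianRing A := IsArtinianRing.of_finite k A
  obtain ⟨m, hm⟩ := Subspace.exists_eq_top_of_iUnion_eq_univ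
    (p := fun m : MaximalSpectrum A ↦ (m.asIdeal.restrictScalars k).comap V.subtype) (by
      refine Set.eq_univ_of_forall fun x ↦ Set.mem_iUnion.mpr ?_
      obtain ⟨m, hm, hxm⟩ := hV x x.2
      exact ⟨⟨m, hm⟩, hxm⟩)
  refine ⟨m.asIdeal, m.isMaximal, fun x hx ↦ ?_⟩
  have h : (⟨x, hx⟩ : V) ∈ (m.asIdeal.restrictScalars k).comap V.subtype := hm ▸ trivial
  exact h


/-- Let `k` be an infinite field and `A` a finite-dimensional commutative `k`-algebra with
`dim_k A ≥ 2`.  If `η : A → k` is a surjective `k`-linear map whose kernel contains no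
nonzero ideal of `A`, then some element of `ker η` is a unit of `A`; equivalently, `ker η`
is not contained in the union of the maximal ideals of `A`. -/
theorem generalized_trace_unit (k A : Type*) [Field k] [Infinite k] [CommRing A]
    [Algebra k A] [FiniteDimensional k A] (hdim : 2 ≤ Module.finrank k A)
    (η : A →ₗ[k] k) (hsurj : Function.Surjective η)
    (hker : ∀ I : Ideal A, (∀ x ∈ I, η x = 0) → I = ⊥) :
    (∃ a : A, η a = 0 ∧ IsUnit a)
    ∧ ¬ (∀ x : A, η x = 0 → ∃ m : Ideal A, m.IsMaximal ∧ x ∈ m) := by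
  have key : ¬ (∀ x : A, η x = 0 → ∃ m : Ideal A, m.IsMaximal ∧ x ∈ m) := by
    intro h
    obtain ⟨m, hm, hle⟩ := Submodule.exists_isMaximal_of_subset_iUnion (LinearMap.ker η) h
    have hbot : m = ⊥ := hker m fun x hx ↦ by
      by_contra hne
      exact hm.ne_top (m.eq_top_of_ker_le_of_apply_ne_zero η hle hx hne)
    have hinj : Function.Injective η := (injective_iff_map_eq_zero η).mpr fun x hx ↦ by
      simpa [hbot] using hle x hx
    have := LinearMap.finrank_le_finrank_of_injective hinj
    rw [Module.finrank_self] at this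
    omega
  refine ⟨?_, key⟩
  by_contra! h
  exact key fun x hx ↦ exists_max_ideal_of_mem_nonunits (h x hx)
end
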